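/- arXiv:2306.04638 — 2 statements merged into one kernel-verified Lean document; each statement's English description precedes it below -/
import Mathlib

section
/- The convergent series ∑_{k=1}^∞ (H_{3k} − H_{2k})/(k·2^k·C(3k,k)) equals 2G/5 + (log 2)²/10 − (π·log 2)/20 − π²/40, where G is Catalan's constant. -/
open scoped BigOperators

/-- The `m`-th harmonic number `H_m = ∑_{j=1}^m 1/j`. -/
noncomputable def harmonicNum (m : ℕ) : ℝ := ∑ j ∈ Finset.range m, 1 / (j + 1 : ℝ)

/-- Catalan's constant `G = ∑_{n=0}^∞ (-1)^n/(2n+1)²`. -/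
noncomputable def catalanG : ℝ := ∑' n : ℕ, (-1) ^ n / (2 * n + 1 : ℝ) ^ 2

open MeasureTheory Set

lemma intervalIntegrable_log_mul {f : ℝ → ℝ} (hf : ContinuousOn f (Icc 0 1)) :
    IntervalIntegrable (fun x => Real.log x * f x) volume 0 1 :=
  intervalIntegral.intervalIntegrable_log'.mul_continuousOn
    (by rwa [uIcc_of_le zero_le_one])

lemma intervalIntegrable_log_one_sub_mul {f : ℝ → ℝ} (hf : ContinuousOn f (Icc 0 1)) :
    IntervalIntegrable (fun x => Real.log (1 - x) * f x) volume 0 1 := by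
  have h := (intervalIntegral.intervalIntegrable_log' (a := 0) (b := 1)).comp_sub_left 1
  simp only [sub_zero, sub_self] at h
  exact h.symm.mul_continuousOn (by rwa [uIcc_of_le zero_le_one])

lemma hasSum_integral_log_mul {p : ℕ → ℝ → ℝ} {s : ℕ → ℝ} {f : ℝ → ℝ}
    (hp : ∀ n, Continuous (p n)) (hp0 : ∀ n, ∀ x ∈ Ioo (0 : ℝ) 1, 0 ≤ p n x)
    (hs : Summable fun n => |s n| * ∫ x in (0 : ℝ)..1, Real.log x * p n x)
    (hf : ∀ x ∈ Ioo (0 : ℝ) 1, HasSum (fun n => s n * p n x) (f x)) :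
    HasSum (fun n => s n * ∫ x in (0 : ℝ)..1, Real.log x * p n x)
      (∫ x in (0 : ℝ)..1, Real.log x * f x) := by
  simp only [intervalIntegral.integral_of_le zero_le_one, integral_Ioc_eq_integral_Ioo] at hs ⊢
  have hint (n : ℕ) : Integrable (fun x => s n * (Real.log x * p n x))
      (volume.restrict (Ioo 0 1)) :=
    (((intervalIntegrable_iff_integrableOn_Ioo_of_le zero_le_one).1
      (intervalIntegrable_log_mul (hp n).continuousOn)).const_mul (s n))
  have hnorm (n : ℕ) : ∫ x in Ioo (0 : ℝ) 1, ‖s n * (Real.log x * p n x)‖ =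
      -(|s n| * ∫ x in Ioo (0 : ℝ) 1, Real.log x * p n x) := by
    rw [← integral_const_mul, ← integral_neg]
    refine setIntegral_congr_fun measurableSet_Ioo fun x hx => ?_
    have := mul_nonpos_of_nonpos_of_nonneg (a := Real.log x)
      (Real.log_nonpos (le_of_lt hx.1) (le_of_lt hx.2)) (hp0 n x hx)
    simp only [Real.norm_eq_abs]
    rw [abs_mul, abs_of_nonpos this, mul_neg]
  have h := hasSum_integral_of_summable_integral_norm hint
    (by simpa only [hnorm] using hs.neg)
  simp only [integral_const_mul] at h
  have hval : ∫ x in Ioo (0 : ℝ) 1, Real.log x * f x =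
      ∫ x in Ioo (0 : ℝ) 1, ∑' n, s n * (Real.log x * p n x) := by
    refine setIntegral_congr_fun measurableSet_Ioo fun x hx => ?_
    have h2 := (hf x hx).mul_left (Real.log x)
    simp only [mul_left_comm (Real.log x)] at h2
    exact h2.tsum_eq.symm
  rwa [hval]

lemma integral_log_mul_pow (m : ℕ) :
    ∫ x in (0 : ℝ)..1, Real.log x * x ^ m = -(1 / ((m : ℝ) + 1) ^ 2) := by
  have hm : (m : ℝ) + 1 ≠ 0 := by positivity
  rw [intervalIntegral.integral_eq_sub_of_hasDerivAt_of_le (f := fun x : ℝ =>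
    x ^ m * (x * Real.log x) / (m + 1) - x ^ (m + 1) / (m + 1) ^ 2) zero_le_one]
  · simp
  · have := Real.continuous_mul_log
    fun_prop
  · intro x hx
    have hx0 : x ≠ 0 := hx.1.ne'
    have h := (((hasDerivAt_pow (m + 1) x).mul (Real.hasDerivAt_log hx0)).div_const
      ((m : ℝ) + 1)).sub ((hasDerivAt_pow (m + 1) x).div_const (((m : ℝ) + 1) ^ 2))
    convert h using 1
    · ext y
      simp only [Pi.sub_apply, Pi.mul_apply]
      ring
    · push_cast [Nat.add_sub_cancel]
      field_simp
      ring
  · exact intervalIntegrable_log_mul (by fun_prop)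

lemma harmonicNum_succ (m : ℕ) : harmonicNum (m + 1) = harmonicNum m + 1 / ((m : ℝ) + 1) := by
  simp [harmonicNum, Finset.sum_range_succ]

lemma integral_log_mul_pow_mul_one_sub_pow (k m : ℕ) :
    ∫ x in (0 : ℝ)..1, Real.log x * (x ^ m * (1 - x) ^ k) =
      -((m.factorial : ℝ) * k.factorial / (m + k + 1).factorial *
        (harmonicNum (m + k + 1) - harmonicNum m)) := by
  induction k generalizing m with
  | zero =>
    simp only [pow_zero, mul_one, integral_log_mul_pow, add_zero, harmonicNum_succ,
      Nat.factorial_succ, Nat.factorial_zero]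
    have := Nat.factorial_ne_zero m
    push_cast
    field_simp
    ring
  | succ k ih =>
    have hsub : ∫ x in (0 : ℝ)..1, Real.log x * (x ^ m * (1 - x) ^ (k + 1)) =
        (∫ x in (0 : ℝ)..1, Real.log x * (x ^ m * (1 - x) ^ k)) -
        ∫ x in (0 : ℝ)..1, Real.log x * (x ^ (m + 1) * (1 - x) ^ k) := by
      rw [← intervalIntegral.integral_sub (intervalIntegrable_log_mul (by fun_prop))
        (intervalIntegrable_log_mul (by fun_prop))]
      congr 1
      ext x
      ring
    rw [hsub, ih, ih, show m + 1 + k + 1 = m + k + 1 + 1 by ring,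
      show m + (k + 1) + 1 = m + k + 1 + 1 by ring]
    simp only [harmonicNum_succ, Nat.factorial_succ]
    have := Nat.factorial_ne_zero m
    have := Nat.factorial_ne_zero k
    have := Nat.factorial_ne_zero (m + k)
    push_cast
    field_simp
    ring

lemma hasSum_one_div_succ_sq : HasSum (fun n : ℕ => 1 / ((n : ℝ) + 1) ^ 2) (Real.pi ^ 2 / 6) := by
  have h := (hasSum_nat_add_iff' 1).2 hasSum_zeta_two
  simpa using h

lemma summable_one_div_odd_sq : Summable (fun n : ℕ => 1 / (2 * (n : ℝ) + 1) ^ 2) := by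
  have h := hasSum_one_div_succ_sq.summable.comp_injective
    (show Function.Injective (fun n : ℕ => 2 * n) from fun a b h => by simpa using h)
  simpa [Function.comp_def] using h

lemma hasSum_alternating_one_div_succ_sq :
    HasSum (fun n : ℕ => (-1 : ℝ) ^ n * (1 / ((n : ℝ) + 1) ^ 2)) (Real.pi ^ 2 / 12) := by
  have hE := summable_one_div_odd_sq.hasSum
  have hO : HasSum (fun n : ℕ => 1 / (((2 * n + 1 : ℕ) : ℝ) + 1) ^ 2) (Real.pi ^ 2 / 24) := by
    have h := hasSum_one_div_succ_sq.mul_left (1 / 4)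
    rw [show 1 / 4 * (Real.pi ^ 2 / 6) = Real.pi ^ 2 / 24 by ring] at h
    have hterm (n : ℕ) : 1 / (((2 * n + 1 : ℕ) : ℝ) + 1) ^ 2 =
        1 / 4 * (1 / ((n : ℝ) + 1) ^ 2) := by
      push_cast
      field_simp
      ring
    simpa only [hterm] using h
  have hsum := HasSum.even_add_odd (f := fun n : ℕ => 1 / ((n : ℝ) + 1) ^ 2)
    (by simpa using hE) hO
  have heq := hsum.unique hasSum_one_div_succ_sq
  have halt := HasSum.even_add_odd (f := fun n : ℕ => (-1 : ℝ) ^ n * (1 / ((n : ℝ) + 1) ^ 2))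
    (by simpa using hE) (by simpa [pow_succ] using hO.neg)
  convert halt using 1
  linarith

lemma integral_log_div_one_add :
    ∫ x in (0 : ℝ)..1, Real.log x * (1 + x)⁻¹ = -(Real.pi ^ 2 / 12) := by
  have h := hasSum_integral_log_mul (p := fun n x => x ^ n) (s := fun n => (-1) ^ n)
    (f := fun x => (1 + x)⁻¹) (fun n => by fun_prop) (fun n x hx => pow_nonneg hx.1.le n)
    (by simpa [integral_log_mul_pow] using hasSum_one_div_succ_sq.summable.neg)
    (fun x hx => by
      simpa [← mul_pow] using hasSum_geometric_of_abs_lt_one (r := -x)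
        (by rw [abs_neg, abs_of_pos hx.1]; exact hx.2))
  refine h.unique ?_
  simpa [integral_log_mul_pow] using hasSum_alternating_one_div_succ_sq.neg

lemma integral_log_div_one_add_sq :
    ∫ x in (0 : ℝ)..1, Real.log x * (1 + x ^ 2)⁻¹ = -catalanG := by
  have h := hasSum_integral_log_mul (p := fun n x => x ^ (2 * n)) (s := fun n => (-1) ^ n)
    (f := fun x => (1 + x ^ 2)⁻¹) (fun n => by fun_prop) (fun n x hx => pow_nonneg hx.1.le _)
    (by simpa [integral_log_mul_pow] using summable_one_div_odd_sq.neg)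
    (fun x hx => by
      have hx2 : x ^ 2 < 1 := pow_lt_one₀ hx.1.le hx.2 two_ne_zero
      simpa [pow_mul, ← mul_pow] using hasSum_geometric_of_abs_lt_one (r := -x ^ 2)
        (by rw [abs_neg, abs_of_nonneg (sq_nonneg x)]; exact hx2))
  rw [← h.tsum_eq, catalanG, ← tsum_neg]
  refine tsum_congr fun n => ?_
  simp [integral_log_mul_pow, div_eq_mul_inv]

lemma integral_comp_sq {g f : ℝ → ℝ} (h : ∀ u ∈ Ioo (0 : ℝ) 1, 2 * u * g (u ^ 2) = f u) :
    ∫ x in (0 : ℝ)..1, g x = ∫ u in (0 : ℝ)..1, f u := by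
  have himg : (fun u : ℝ => u ^ 2) '' Ioo 0 1 = Ioo 0 1 := by
    ext x
    constructor
    · rintro ⟨u, hu, rfl⟩
      exact ⟨pow_pos hu.1 2, pow_lt_one₀ hu.1.le hu.2 two_ne_zero⟩
    · intro hx
      exact ⟨√x, ⟨Real.sqrt_pos.2 hx.1, (Real.sqrt_lt' one_pos).2 (by simpa using hx.2)⟩,
        Real.sq_sqrt hx.1.le⟩
  have hcov := integral_image_eq_integral_abs_deriv_smul (s := Ioo (0 : ℝ) 1)
    (f := fun u => u ^ 2) (f' := fun u => 2 * u) measurableSet_Ioo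
    (fun u _ => by simpa using (hasDerivAt_pow 2 u).hasDerivWithinAt)
    (fun u hu v hv huv => (pow_left_inj₀ hu.1.le hv.1.le two_ne_zero).1 huv) g
  rw [himg] at hcov
  simp only [intervalIntegral.integral_of_le zero_le_one, integral_Ioc_eq_integral_Ioo]
  rw [hcov]
  refine setIntegral_congr_fun measurableSet_Ioo fun u hu => ?_
  have h0 : 0 < 2 * u := by linarith [hu.1]
  simp only [smul_eq_mul, abs_of_pos h0, h u hu]

lemma integral_comp_one_sub_div_one_add {g f : ℝ → ℝ}
    (h : ∀ u ∈ Ioo (0 : ℝ) 1, 2 / (1 + u) ^ 2 * g ((1 - u) / (1 + u)) = f u) :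
    ∫ x in (0 : ℝ)..1, g x = ∫ u in (0 : ℝ)..1, f u := by
  have hmaps : MapsTo (fun u : ℝ => (1 - u) / (1 + u)) (Ioo 0 1) (Ioo 0 1) := by
    rintro u ⟨h0, h1⟩
    have : 0 < 1 + u := by linarith
    exact ⟨div_pos (by linarith) this, (div_lt_one this).2 (by linarith)⟩
  have hinv : ∀ u ∈ Ioo (0 : ℝ) 1,
      (1 - (1 - u) / (1 + u)) / (1 + (1 - u) / (1 + u)) = u := by
    rintro u ⟨h0, h1⟩
    have : 1 + u ≠ 0 := by linarith
    field_simp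
    ring
  have himg : (fun u : ℝ => (1 - u) / (1 + u)) '' Ioo 0 1 = Ioo 0 1 :=
    hmaps.image_subset.antisymm fun x hx => ⟨_, hmaps hx, hinv x hx⟩
  have hcov := integral_image_eq_integral_abs_deriv_smul (s := Ioo (0 : ℝ) 1)
    (f := fun u => (1 - u) / (1 + u)) (f' := fun u => -(2 / (1 + u) ^ 2)) measurableSet_Ioo
    (fun u hu => by
      have h0 : 1 + u ≠ 0 := by linarith [hu.1]
      have hd := ((hasDerivAt_id u).const_sub 1).div ((hasDerivAt_id u).const_add 1) h0
      refine (hd.congr_deriv ?_).hasDerivWithinAt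
      simp only [id]
      field_simp
      ring)
    (fun u hu v hv huv => by
      rw [← hinv u hu, ← hinv v hv]
      simp only at huv
      rw [huv]) g
  rw [himg] at hcov
  simp only [intervalIntegral.integral_of_le zero_le_one, integral_Ioc_eq_integral_Ioo]
  rw [hcov]
  refine setIntegral_congr_fun measurableSet_Ioo fun u hu => ?_
  simp only [smul_eq_mul, abs_neg]
  rw [abs_of_nonneg (by positivity), h u hu]

lemma intervalIntegrable_log_one_add_mul {f : ℝ → ℝ} (hf : ContinuousOn f (Icc 0 1)) :
    IntervalIntegrable (fun x => Real.log (1 + x) * f x) volume 0 1 := by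
  refine ContinuousOn.intervalIntegrable ?_
  rw [uIcc_of_le zero_le_one]
  exact ContinuousOn.mul (ContinuousOn.log (by fun_prop) fun x hx => by linarith [hx.1]) hf

lemma continuousOn_inv_one_add : ContinuousOn (fun x : ℝ => (1 + x)⁻¹) (Icc 0 1) :=
  ContinuousOn.inv₀ (by fun_prop) fun x hx => by linarith [hx.1]

lemma continuousOn_inv_one_add_sq : ContinuousOn (fun x : ℝ => (1 + x ^ 2)⁻¹) (Icc 0 1) :=
  ContinuousOn.inv₀ (by fun_prop) fun x _ => by positivity

lemma continuousOn_mul_inv_one_add_sq :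
    ContinuousOn (fun x : ℝ => x * (1 + x ^ 2)⁻¹) (Icc 0 1) :=
  continuousOn_id.mul continuousOn_inv_one_add_sq

lemma intervalIntegrable_of_continuousOn_Icc {f : ℝ → ℝ} (hf : ContinuousOn f (Icc 0 1)) :
    IntervalIntegrable f volume 0 1 :=
  ContinuousOn.intervalIntegrable (by rwa [uIcc_of_le zero_le_one])

lemma log_one_add_one_sub_div_one_add {u : ℝ} (hu : u ∈ Ioo (0 : ℝ) 1) :
    Real.log (1 + (1 - u) / (1 + u)) = Real.log 2 - Real.log (1 + u) := by
  have h : 1 + u ≠ 0 := by linarith [hu.1]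
  rw [← Real.log_div two_ne_zero h]
  congr 1
  field_simp
  ring

lemma log_one_sub_one_sub_div_one_add {u : ℝ} (hu : u ∈ Ioo (0 : ℝ) 1) :
    Real.log (1 - (1 - u) / (1 + u)) = Real.log 2 + Real.log u - Real.log (1 + u) := by
  have h : 1 + u ≠ 0 := by linarith [hu.1]
  rw [← Real.log_mul two_ne_zero hu.1.ne', ← Real.log_div (mul_ne_zero two_ne_zero hu.1.ne') h]
  congr 1
  field_simp
  ring

lemma inv_one_add_sq_one_sub_div_one_add {u : ℝ} (hu : u ∈ Ioo (0 : ℝ) 1) :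
    2 / (1 + u) ^ 2 * (1 + ((1 - u) / (1 + u)) ^ 2)⁻¹ = (1 + u ^ 2)⁻¹ := by
  have h : 1 + u ≠ 0 := by linarith [hu.1]
  have h2 : 1 + ((1 - u) / (1 + u)) ^ 2 = 2 * (1 + u ^ 2) / (1 + u) ^ 2 := by
    field_simp
    ring
  rw [h2]
  have : 1 + u ^ 2 ≠ 0 := by positivity
  field_simp

lemma inv_one_add_one_sub_div_one_add {u : ℝ} (hu : u ∈ Ioo (0 : ℝ) 1) :
    2 / (1 + u) ^ 2 * (1 + (1 - u) / (1 + u))⁻¹ = (1 + u)⁻¹ := by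
  have h : 1 + u ≠ 0 := by linarith [hu.1]
  have h2 : 1 + (1 - u) / (1 + u) = 2 / (1 + u) := by
    field_simp
    ring
  rw [h2]
  field_simp

lemma one_sub_div_one_add_mul_inv_one_add_sq {u : ℝ} (hu : u ∈ Ioo (0 : ℝ) 1) :
    (1 - u) / (1 + u) * (1 + u ^ 2)⁻¹ = (1 + u)⁻¹ - u * (1 + u ^ 2)⁻¹ := by
  have h : 1 + u ≠ 0 := by linarith [hu.1]
  have : 1 + u ^ 2 ≠ 0 := by positivity
  field_simp
  ring

lemma integral_inv_one_add : ∫ x in (0 : ℝ)..1, (1 + x)⁻¹ = Real.log 2 := by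
  have h := intervalIntegral.integral_comp_add_left (fun x : ℝ => x⁻¹) (a := 0) (b := 1) 1
  simp only [h]
  rw [integral_inv_of_pos (by norm_num) (by norm_num)]
  norm_num

lemma integral_id_mul_inv_one_add_sq :
    ∫ x in (0 : ℝ)..1, x * (1 + x ^ 2)⁻¹ = Real.log 2 / 2 := by
  have h := integral_comp_sq (g := fun x => (1 + x)⁻¹) (f := fun x => 2 * (x * (1 + x ^ 2)⁻¹))
    (fun u _ => by ring)
  rw [integral_inv_one_add, intervalIntegral.integral_const_mul] at h
  linarith

lemma integral_log_mul_id_mul_inv_one_add_sq :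
    ∫ x in (0 : ℝ)..1, Real.log x * (x * (1 + x ^ 2)⁻¹) = -(Real.pi ^ 2 / 48) := by
  have h := integral_comp_sq (g := fun x => Real.log x * (1 + x)⁻¹)
    (f := fun x => 4 * (Real.log x * (x * (1 + x ^ 2)⁻¹)))
    (fun u _ => by simp only [Real.log_pow]; push_cast; ring)
  rw [integral_log_div_one_add, intervalIntegral.integral_const_mul] at h
  linarith

lemma integral_log_one_add_div_one_add :
    ∫ x in (0 : ℝ)..1, Real.log (1 + x) * (1 + x)⁻¹ = Real.log 2 ^ 2 / 2 := by
  have h := integral_comp_one_sub_div_one_add (g := fun x => Real.log (1 + x) * (1 + x)⁻¹)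
    (f := fun x => Real.log 2 * (1 + x)⁻¹ - Real.log (1 + x) * (1 + x)⁻¹)
    (fun u hu => by
      rw [mul_left_comm, inv_one_add_one_sub_div_one_add hu, log_one_add_one_sub_div_one_add hu]
      ring)
  rw [intervalIntegral.integral_sub
    ((intervalIntegrable_of_continuousOn_Icc continuousOn_inv_one_add).const_mul _)
    (intervalIntegrable_log_one_add_mul continuousOn_inv_one_add),
    intervalIntegral.integral_const_mul, integral_inv_one_add] at h
  linarith

lemma integral_log_one_sub_div_one_add :
    ∫ x in (0 : ℝ)..1, Real.log (1 - x) * (1 + x)⁻¹ =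
      Real.log 2 ^ 2 / 2 - Real.pi ^ 2 / 12 := by
  have h := integral_comp_one_sub_div_one_add (g := fun x => Real.log (1 - x) * (1 + x)⁻¹)
    (f := fun x => Real.log 2 * (1 + x)⁻¹ + Real.log x * (1 + x)⁻¹ -
      Real.log (1 + x) * (1 + x)⁻¹)
    (fun u hu => by
      rw [mul_left_comm, inv_one_add_one_sub_div_one_add hu, log_one_sub_one_sub_div_one_add hu]
      ring)
  have h2 := (intervalIntegrable_of_continuousOn_Icc continuousOn_inv_one_add).const_mul
    (Real.log 2)
  have h3 := intervalIntegrable_log_mul continuousOn_inv_one_add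
  rw [intervalIntegral.integral_sub (h2.add h3)
    (intervalIntegrable_log_one_add_mul continuousOn_inv_one_add),
    intervalIntegral.integral_add h2 h3,
    intervalIntegral.integral_const_mul, integral_inv_one_add, integral_log_div_one_add,
    integral_log_one_add_div_one_add] at h
  linarith

lemma integral_inv_one_add_sq_zero_one :
    ∫ x in (0 : ℝ)..1, (1 + x ^ 2)⁻¹ = Real.pi / 4 := by
  simp [integral_inv_one_add_sq]

lemma integral_log_one_add_div_one_add_sq :
    ∫ x in (0 : ℝ)..1, Real.log (1 + x) * (1 + x ^ 2)⁻¹ = Real.pi * Real.log 2 / 8 := by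
  have h := integral_comp_one_sub_div_one_add (g := fun x => Real.log (1 + x) * (1 + x ^ 2)⁻¹)
    (f := fun x => Real.log 2 * (1 + x ^ 2)⁻¹ - Real.log (1 + x) * (1 + x ^ 2)⁻¹)
    (fun u hu => by
      rw [mul_left_comm, inv_one_add_sq_one_sub_div_one_add hu,
        log_one_add_one_sub_div_one_add hu]
      ring)
  rw [intervalIntegral.integral_sub
    ((intervalIntegrable_of_continuousOn_Icc continuousOn_inv_one_add_sq).const_mul _)
    (intervalIntegrable_log_one_add_mul continuousOn_inv_one_add_sq),
    intervalIntegral.integral_const_mul, integral_inv_one_add_sq_zero_one] at h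
  linarith

lemma integral_log_one_sub_div_one_add_sq :
    ∫ x in (0 : ℝ)..1, Real.log (1 - x) * (1 + x ^ 2)⁻¹ =
      Real.pi * Real.log 2 / 8 - catalanG := by
  have h := integral_comp_one_sub_div_one_add (g := fun x => Real.log (1 - x) * (1 + x ^ 2)⁻¹)
    (f := fun x => Real.log 2 * (1 + x ^ 2)⁻¹ + Real.log x * (1 + x ^ 2)⁻¹ -
      Real.log (1 + x) * (1 + x ^ 2)⁻¹)
    (fun u hu => by
      rw [mul_left_comm, inv_one_add_sq_one_sub_div_one_add hu,
        log_one_sub_one_sub_div_one_add hu]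
      ring)
  have h2 := (intervalIntegrable_of_continuousOn_Icc continuousOn_inv_one_add_sq).const_mul
    (Real.log 2)
  have h3 := intervalIntegrable_log_mul continuousOn_inv_one_add_sq
  rw [intervalIntegral.integral_sub (h2.add h3)
    (intervalIntegrable_log_one_add_mul continuousOn_inv_one_add_sq),
    intervalIntegral.integral_add h2 h3,
    intervalIntegral.integral_const_mul, integral_inv_one_add_sq_zero_one,
    integral_log_div_one_add_sq, integral_log_one_add_div_one_add_sq] at h
  linarith

lemma integral_log_one_sub_mul_id_mul_inv_one_add_sq :
    ∫ x in (0 : ℝ)..1, Real.log (1 - x) * (x * (1 + x ^ 2)⁻¹) =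
      Real.log 2 ^ 2 / 8 - 5 * Real.pi ^ 2 / 96 := by
  have hcov := integral_comp_one_sub_div_one_add
    (g := fun x => Real.log (1 - x) * (x * (1 + x ^ 2)⁻¹))
    (f := fun x => (Real.log 2 * (1 + x)⁻¹ + Real.log x * (1 + x)⁻¹ -
      Real.log (1 + x) * (1 + x)⁻¹) - (Real.log 2 * (x * (1 + x ^ 2)⁻¹) +
        Real.log x * (x * (1 + x ^ 2)⁻¹) - Real.log (1 + x) * (x * (1 + x ^ 2)⁻¹)))
    (fun u hu => by
      rw [mul_left_comm, mul_left_comm (2 / (1 + u) ^ 2), inv_one_add_sq_one_sub_div_one_add hu,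
        log_one_sub_one_sub_div_one_add hu, one_sub_div_one_add_mul_inv_one_add_sq hu]
      ring)
  have i1 := (intervalIntegrable_of_continuousOn_Icc continuousOn_inv_one_add).const_mul
    (Real.log 2)
  have i2 := intervalIntegrable_log_mul continuousOn_inv_one_add
  have i3 := intervalIntegrable_log_one_add_mul continuousOn_inv_one_add
  have j1 := (intervalIntegrable_of_continuousOn_Icc continuousOn_mul_inv_one_add_sq).const_mul
    (Real.log 2)
  have j2 := intervalIntegrable_log_mul continuousOn_mul_inv_one_add_sq
  have j3 := intervalIntegrable_log_one_add_mul continuousOn_mul_inv_one_add_sq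
  have j4 := intervalIntegrable_log_one_sub_mul continuousOn_mul_inv_one_add_sq
  rw [intervalIntegral.integral_sub ((i1.add i2).sub i3) ((j1.add j2).sub j3),
    intervalIntegral.integral_sub (i1.add i2) i3, intervalIntegral.integral_sub (j1.add j2) j3,
    intervalIntegral.integral_add i1 i2, intervalIntegral.integral_add j1 j2,
    intervalIntegral.integral_const_mul, intervalIntegral.integral_const_mul,
    integral_inv_one_add, integral_log_div_one_add, integral_log_one_add_div_one_add,
    integral_id_mul_inv_one_add_sq, integral_log_mul_id_mul_inv_one_add_sq] at hcov
  have hsq := integral_comp_sq (g := fun x => Real.log (1 - x) * (1 + x)⁻¹)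
    (f := fun x => 2 * (Real.log (1 - x) * (x * (1 + x ^ 2)⁻¹) +
      Real.log (1 + x) * (x * (1 + x ^ 2)⁻¹)))
    (fun u hu => by
      have h1 : 1 - u ≠ 0 := by linarith [hu.2]
      have h2 : 1 + u ≠ 0 := by linarith [hu.1]
      simp only [show 1 - u ^ 2 = (1 - u) * (1 + u) by ring, Real.log_mul h1 h2]
      ring)
  rw [integral_log_one_sub_div_one_add, intervalIntegral.integral_const_mul,
    intervalIntegral.integral_add j4 j3] at hsq
  linarith

lemma integral_log_mul_sq_div_cubic :
    ∫ x in (0 : ℝ)..1, Real.log x * (x ^ 2 / (2 - x ^ 2 * (1 - x))) =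
      -(2 * catalanG / 5 + Real.log 2 ^ 2 / 10 - Real.pi * Real.log 2 / 20 -
        Real.pi ^ 2 / 40) := by
  have hquad (x : ℝ) : 1 + (1 - x) ^ 2 ≠ 0 := by positivity
  have hpf : ∫ x in (0 : ℝ)..1, Real.log x * (x ^ 2 / (2 - x ^ 2 * (1 - x))) =
      ∫ x in (0 : ℝ)..1, (1 / 5 * (Real.log x * (1 + x)⁻¹) +
        Real.log x * ((4 * x - 2) / 5 * (1 + (1 - x) ^ 2)⁻¹)) := by
    refine intervalIntegral.integral_congr_Ioo_of_le zero_le_one fun x hx => ?_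
    have h1 : 1 + x ≠ 0 := by linarith [hx.1]
    have h2 := hquad x
    simp only [show 2 - x ^ 2 * (1 - x) = (1 + x) * (1 + (1 - x) ^ 2) by ring]
    field_simp
    ring
  have hrefl := intervalIntegral.integral_comp_sub_left (a := 0) (b := 1)
    (fun x => Real.log x * ((4 * x - 2) / 5 * (1 + (1 - x) ^ 2)⁻¹)) 1
  have hlin : (fun x : ℝ => Real.log (1 - x) *
      ((4 * (1 - x) - 2) / 5 * (1 + (1 - (1 - x)) ^ 2)⁻¹)) = fun x =>
      2 / 5 * (Real.log (1 - x) * (1 + x ^ 2)⁻¹) -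
        4 / 5 * (Real.log (1 - x) * (x * (1 + x ^ 2)⁻¹)) := by
    ext x
    rw [sub_sub_cancel]
    ring
  rw [hlin, sub_self, sub_zero, intervalIntegral.integral_sub
    ((intervalIntegrable_log_one_sub_mul continuousOn_inv_one_add_sq).const_mul _)
    ((intervalIntegrable_log_one_sub_mul continuousOn_mul_inv_one_add_sq).const_mul _),
    intervalIntegral.integral_const_mul, intervalIntegral.integral_const_mul,
    integral_log_one_sub_div_one_add_sq, integral_log_one_sub_mul_id_mul_inv_one_add_sq] at hrefl
  have hcont : ContinuousOn (fun x : ℝ => (4 * x - 2) / 5 * (1 + (1 - x) ^ 2)⁻¹) (Icc 0 1) :=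
    ContinuousOn.mul (by fun_prop)
      (ContinuousOn.inv₀ (f := fun x : ℝ => 1 + (1 - x) ^ 2) (by fun_prop) fun x _ => hquad x)
  rw [hpf, intervalIntegral.integral_add
    ((intervalIntegrable_log_mul continuousOn_inv_one_add).const_mul _)
    (intervalIntegrable_log_mul hcont),
    intervalIntegral.integral_const_mul, integral_log_div_one_add, ← hrefl]
  ring

lemma harmonicNum_add_sub_nonneg (m k : ℕ) : 0 ≤ harmonicNum (m + k) - harmonicNum m := by
  rw [harmonicNum, harmonicNum, Finset.sum_range_add, add_sub_cancel_left]
  positivity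

lemma harmonicNum_add_sub_le (m k : ℕ) : harmonicNum (m + k) - harmonicNum m ≤ k := by
  induction k with
  | zero => simp
  | succ k ih =>
    rw [← add_assoc, harmonicNum_succ]
    have : 1 / (((m + k : ℕ) : ℝ) + 1) ≤ 1 := by
      rw [div_le_one (by positivity)]
      exact le_add_of_nonneg_left (Nat.cast_nonneg _)
    push_cast at this ⊢
    linarith

lemma half_pow_mul_integral_log (k : ℕ) :
    (1 / 2 : ℝ) ^ (k + 1) *
        ∫ x in (0 : ℝ)..1, Real.log x * (x ^ (2 * (k + 1)) * (1 - x) ^ k) =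
      -((harmonicNum (3 * (k + 1)) - harmonicNum (2 * (k + 1))) /
        ((k + 1 : ℝ) * 2 ^ (k + 1) * (Nat.choose (3 * (k + 1)) (k + 1) : ℝ))) := by
  rw [integral_log_mul_pow_mul_one_sub_pow, show 2 * (k + 1) + k + 1 = 3 * (k + 1) by ring,
    Nat.cast_choose ℝ (show k + 1 ≤ 3 * (k + 1) by lia),
    show 3 * (k + 1) - (k + 1) = 2 * (k + 1) by lia, Nat.factorial_succ k,
    one_div_pow]
  have := Nat.factorial_ne_zero k
  have := Nat.factorial_ne_zero (2 * (k + 1))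
  have := Nat.factorial_ne_zero (3 * (k + 1))
  push_cast
  field_simp

lemma summable_harmonicNum_sub_div_choose :
    Summable fun k : ℕ => (harmonicNum (3 * (k + 1)) - harmonicNum (2 * (k + 1))) /
        ((k + 1 : ℝ) * 2 ^ (k + 1) * (Nat.choose (3 * (k + 1)) (k + 1) : ℝ)) := by
  have hgeom : Summable fun k : ℕ => (1 / 2 : ℝ) ^ (k + 1) :=
    (summable_nat_add_iff 1).2 summable_geometric_two
  have hidx (k : ℕ) : 3 * (k + 1) = 2 * (k + 1) + (k + 1) := by ring
  refine hgeom.of_nonneg_of_le (fun k => ?_) fun k => ?_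
  · rw [hidx]
    exact div_nonneg (harmonicNum_add_sub_nonneg _ _) (by positivity)
  · have hle := harmonicNum_add_sub_le (2 * (k + 1)) (k + 1)
    rw [← hidx] at hle
    have hc : (1 : ℝ) ≤ (Nat.choose (3 * (k + 1)) (k + 1) : ℝ) := by
      exact_mod_cast Nat.choose_pos (show k + 1 ≤ 3 * (k + 1) by lia)
    rw [div_le_iff₀ (by positivity), one_div_pow]
    calc harmonicNum (3 * (k + 1)) - harmonicNum (2 * (k + 1)) ≤ (k + 1 : ℝ) * 1 := by
          simpa using hle
      _ ≤ (k + 1 : ℝ) * (Nat.choose (3 * (k + 1)) (k + 1) : ℝ) := by gcongr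
      _ = _ := by field_simp

theorem sun_inv3k_H3k_H2k :
    ∑' k : ℕ, (harmonicNum (3 * (k + 1)) - harmonicNum (2 * (k + 1))) /
        ((k + 1 : ℝ) * 2 ^ (k + 1) * (Nat.choose (3 * (k + 1)) (k + 1) : ℝ)) =
      2 * catalanG / 5 + Real.log 2 ^ 2 / 10 - Real.pi * Real.log 2 / 20 - Real.pi ^ 2 / 40 := by
  have h := hasSum_integral_log_mul (p := fun k x => x ^ (2 * (k + 1)) * (1 - x) ^ k)
    (s := fun k => (1 / 2) ^ (k + 1)) (f := fun x => x ^ 2 / (2 - x ^ 2 * (1 - x)))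
    (fun k => by fun_prop)
    (fun k x hx => mul_nonneg (pow_nonneg hx.1.le _) (pow_nonneg (sub_nonneg.2 hx.2.le) _))
    (by
      simp only [abs_of_nonneg (show (0 : ℝ) ≤ (1 / 2) ^ (_ + 1) by positivity),
        half_pow_mul_integral_log]
      exact summable_harmonicNum_sub_div_choose.neg)
    (fun x hx => by
      have hx2 : x ^ 2 < 1 := pow_lt_one₀ hx.1.le hx.2 two_ne_zero
      have h0 : 0 ≤ x ^ 2 * (1 - x) := mul_nonneg (sq_nonneg x) (sub_nonneg.2 hx.2.le)
      have h1 : x ^ 2 * (1 - x) < 1 := by nlinarith [hx.1, hx.2, sq_nonneg x]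
      have hg := (hasSum_geometric_of_lt_one (r := x ^ 2 * (1 - x) / 2) (by positivity)
        (by linarith)).mul_left (x ^ 2 / 2)
      have hterm (k : ℕ) : (1 / 2) ^ (k + 1) * (x ^ (2 * (k + 1)) * (1 - x) ^ k) =
          x ^ 2 / 2 * (x ^ 2 * (1 - x) / 2) ^ k := by
        rw [one_div_pow, div_pow, mul_pow, ← pow_mul]
        field_simp
        ring
      have hval : x ^ 2 / (2 - x ^ 2 * (1 - x)) =
          x ^ 2 / 2 * (1 - x ^ 2 * (1 - x) / 2)⁻¹ := by
        rw [show 1 - x ^ 2 * (1 - x) / 2 = (2 - x ^ 2 * (1 - x)) / 2 by ring, inv_div,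
          div_mul_div_comm, mul_comm 2, mul_div_mul_right _ _ two_ne_zero]
      simpa only [hterm, hval] using hg)
  simp only [half_pow_mul_integral_log, integral_log_mul_sq_div_cubic] at h
  simpa using h.neg.tsum_eq
end

section
/- For every real φ with 0 < φ < π/3, the convergent series ∑_{k=0}^∞ (C(3k,k)/27^k)·(2·cos(3φ/2))^{2k}·H_{2k} equals (√3/sin(3φ/2))·[ cos(φ/2)·log( 2·cos(φ/2)·cos(φ/2 − π/3)/(√3·sin φ) ) + cos(φ/2 − π/3)·log( 2·cos(φ/2)·cos(φ/2 − π/3)/(√3·sin(2π/3 − φ)) ) ]. -/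
open scoped BigOperators
open Real

/-- `|c k|` is bounded by a polynomial in `k` times `4⁻ᵏ`. -/
def PolyGeomBounded (c : ℕ → ℝ) : Prop :=
  ∃ (M : ℝ) (m : ℕ), ∀ k, |c k| * 4 ^ k ≤ M * (k + 1 : ℝ) ^ m

/-- The coefficients of the formal derivative of `∑ c k * s ^ k`. -/
def derivCoeff (c : ℕ → ℝ) (k : ℕ) : ℝ := (k + 1) * c (k + 1)

lemma PolyGeomBounded.derivCoeff {c : ℕ → ℝ} (hc : PolyGeomBounded c) :
    PolyGeomBounded (derivCoeff c) := by
  obtain ⟨M, m, h⟩ := hc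
  have hM : 0 ≤ M := (abs_nonneg (c 0)).trans (by simpa using h 0)
  refine ⟨M * 2 ^ m, m + 1, fun k => ?_⟩
  have hk := h (k + 1)
  have hk0 : (0 : ℝ) ≤ k := k.cast_nonneg
  rw [_root_.derivCoeff, abs_mul, abs_of_nonneg (by positivity : (0 : ℝ) ≤ k + 1)]
  have h1 : |c (k + 1)| * 4 ^ k ≤ |c (k + 1)| * 4 ^ (k + 1) := by
    gcongr <;> norm_num
  have h2 : M * (((k + 1 : ℕ) : ℝ) + 1) ^ m ≤ M * (2 * (k + 1 : ℝ)) ^ m := by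
    gcongr
    push_cast
    linarith
  calc (k + 1 : ℝ) * |c (k + 1)| * 4 ^ k = (k + 1) * (|c (k + 1)| * 4 ^ k) := by ring
    _ ≤ (k + 1) * (M * (2 * (k + 1 : ℝ)) ^ m) := by
      exact mul_le_mul_of_nonneg_left (h1.trans (hk.trans h2)) (by positivity)
    _ = M * 2 ^ m * (k + 1 : ℝ) ^ (m + 1) := by rw [mul_pow]; ring

lemma PolyGeomBounded.summable_abs {c : ℕ → ℝ} (hc : PolyGeomBounded c) {r : ℝ} (hr0 : 0 ≤ r)
    (hr : r < 4) : Summable fun k => |c k| * r ^ k := by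
  obtain ⟨M, m, h⟩ := hc
  have hlt : ‖r / 4‖ < 1 := by
    rw [Real.norm_eq_abs, abs_of_nonneg (by positivity)]
    linarith
  have hs : Summable fun k : ℕ => M * 2 ^ m * ((k : ℝ) ^ m * (r / 4) ^ k) :=
    (summable_pow_mul_geometric_of_norm_lt_one m hlt).mul_left _
  have key : ∀ k : ℕ, 1 ≤ k → |c k| * r ^ k ≤ M * 2 ^ m * ((k : ℝ) ^ m * (r / 4) ^ k) := by
    intro k hk
    have hk' : (1 : ℝ) ≤ k := by exact_mod_cast hk
    have hM : 0 ≤ M := (abs_nonneg (c 0)).trans (by simpa using h 0)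
    calc |c k| * r ^ k = (|c k| * 4 ^ k) * (r / 4) ^ k := by
          rw [div_pow]; field_simp
      _ ≤ (M * (k + 1 : ℝ) ^ m) * (r / 4) ^ k := by
          have := h k
          gcongr
      _ ≤ (M * (2 * k : ℝ) ^ m) * (r / 4) ^ k := by
          gcongr
          linarith
      _ = _ := by rw [mul_pow]; ring
  rw [← summable_nat_add_iff 1]
  exact Summable.of_nonneg_of_le (fun k => by positivity) (fun k => key (k + 1) (by omega))
    ((summable_nat_add_iff 1).2 hs)

lemma PolyGeomBounded.summable {c : ℕ → ℝ} (hc : PolyGeomBounded c) {s : ℝ} (hs : |s| < 4) :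
    Summable fun k => c k * s ^ k := by
  refine Summable.of_abs ?_
  simpa only [abs_mul, abs_pow] using hc.summable_abs (abs_nonneg s) hs

lemma hasSum_succ_iff_of_zero {f : ℕ → ℝ} (h0 : f 0 = 0) {a : ℝ} :
    HasSum (fun k => f (k + 1)) a ↔ HasSum f a := by
  rw [hasSum_nat_add_iff 1]
  simp [h0]

lemma PolyGeomBounded.hasSum_derivCoeff {c : ℕ → ℝ} (hc : PolyGeomBounded c) {s : ℝ}
    (hs : |s| < 4) :
    HasSum (fun k : ℕ => (k : ℝ) * c k * s ^ (k - 1)) (∑' k, _root_.derivCoeff c k * s ^ k) := by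
  rw [← hasSum_succ_iff_of_zero (by simp)]
  simpa [_root_.derivCoeff] using (hc.derivCoeff.summable hs).hasSum

lemma PolyGeomBounded.hasDerivAt {c : ℕ → ℝ} (hc : PolyGeomBounded c) {s : ℝ} (hs : |s| < 4) :
    HasDerivAt (fun x => ∑' k, c k * x ^ k) (∑' k, _root_.derivCoeff c k * s ^ k) s := by
  obtain ⟨r, hsr, hr⟩ := exists_between hs
  have hr0 : 0 ≤ r := (abs_nonneg s).trans hsr.le
  have hu : Summable fun k : ℕ => |(k : ℝ) * c k| * r ^ (k - 1) := by
    rw [← summable_nat_add_iff 1]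
    simpa [_root_.derivCoeff] using hc.derivCoeff.summable_abs hr0 hr
  have hmem : s ∈ Metric.ball (0 : ℝ) r := by simpa using hsr
  have := hasDerivAt_tsum_of_isPreconnected (g := fun (k : ℕ) x => c k * x ^ k)
    (g' := fun (k : ℕ) x => (k : ℝ) * c k * x ^ (k - 1)) hu Metric.isOpen_ball
    (convex_ball (0 : ℝ) r).isPreconnected
    (fun k y _ => by
      rw [mul_comm (k : ℝ), mul_assoc]
      exact (hasDerivAt_pow k y).const_mul (c k))
    (fun k y hy => by
      rw [Real.norm_eq_abs, abs_mul, abs_pow]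
      have hy' : |y| < r := by simpa using hy
      gcongr)
    hmem (hc.summable hs) hmem
  rwa [(hc.hasSum_derivCoeff hs).tsum_eq] at this

lemma PolyGeomBounded.hasSum_mul_derivCoeff {c : ℕ → ℝ} (hc : PolyGeomBounded c) {s : ℝ}
    (hs : |s| < 4) :
    HasSum (fun k : ℕ => (k : ℝ) * c k * s ^ k) (s * ∑' k, _root_.derivCoeff c k * s ^ k) := by
  refine ((hc.hasSum_derivCoeff hs).mul_left s).congr_fun fun k => ?_
  rcases k with _ | k
  · simp
  · simp only [Nat.add_sub_cancel]
    ring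

/-- A solution of `y'' = -y` on `(0, a)` with vanishing Cauchy data at `a` vanishes. -/
lemma eq_zero_of_harmonic {a : ℝ} {D D₁ D₂ : ℝ → ℝ}
    (h : ∀ v ∈ Set.Ioc 0 a, HasDerivAt D (D₁ v) v)
    (h' : ∀ v ∈ Set.Ioc 0 a, HasDerivAt D₁ (D₂ v) v)
    (hD : ∀ v ∈ Set.Ioo 0 a, D₂ v = -D v) (ha : D a = 0) (ha₁ : D₁ a = 0)
    {v : ℝ} (hv : v ∈ Set.Ioc 0 a) : D v = 0 ∧ D₁ v = 0 := by
  have aux : ∀ E E' : ℝ → ℝ, (∀ x ∈ Set.Ioc 0 a, HasDerivAt E (E' x) x) →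
      (∀ x ∈ Set.Ioo 0 a, E' x = 0) → E a = 0 → E v = 0 := by
    intro E E' hE hE' hEa
    rcases hv.2.eq_or_lt with hva | hva
    · rw [hva, hEa]
    · obtain ⟨x, hx, hslope⟩ := exists_hasDerivAt_eq_slope E E' hva
        (fun x hx => (hE x ⟨hv.1.trans_le hx.1, hx.2⟩).continuousAt.continuousWithinAt)
        (fun x hx => hE x ⟨hv.1.trans hx.1, hx.2.le⟩)
      rw [hE' x ⟨hv.1.trans hx.1, hx.2⟩, eq_comm, div_eq_zero_iff] at hslope
      rcases hslope with h | h <;> linarith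
  have e₁ := aux (fun x => D x * cos x - D₁ x * sin x) _
    (fun x hx => ((h x hx).mul (hasDerivAt_cos x)).sub ((h' x hx).mul (hasDerivAt_sin x)))
    (fun x hx => by rw [hD x hx]; ring) (by simp [ha, ha₁])
  have e₂ := aux (fun x => D x * sin x + D₁ x * cos x) _
    (fun x hx => ((h x hx).mul (hasDerivAt_sin x)).add ((h' x hx).mul (hasDerivAt_cos x)))
    (fun x hx => by rw [hD x hx]; ring) (by simp [ha, ha₁])
  have hcs := sin_sq_add_cos_sq v
  constructor
  · linear_combination cos v * e₁ + sin v * e₂ - D v * hcs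
  · linear_combination -sin v * e₁ + cos v * e₂ - D₁ v * hcs

/-- The coefficients `C(3k, k) / 27 ^ k`. -/
noncomputable def trinomCoeff (k : ℕ) : ℝ := (Nat.choose (3 * k) k : ℝ) / 27 ^ k

/-- The coefficients `C(3k, k) / 27 ^ k * H_{2k}`. -/
noncomputable def trinomHarmonicCoeff (k : ℕ) : ℝ := trinomCoeff k * harmonicNum (2 * k)

lemma choose_three_mul_succ (k : ℕ) :
    (2 * k + 1) * (2 * k + 2) * Nat.choose (3 * (k + 1)) (k + 1) =
      3 * (3 * k + 1) * (3 * k + 2) * Nat.choose (3 * k) k := by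
  have h₁ := Nat.add_choose_mul_factorial_mul_factorial (2 * k) k
  have h₂ := Nat.add_choose_mul_factorial_mul_factorial (2 * (k + 1)) (k + 1)
  rw [show 2 * k + k = 3 * k by ring] at h₁
  rw [show 2 * (k + 1) + (k + 1) = 3 * (k + 1) by ring] at h₂
  rw [show 3 * (k + 1) = 3 * k + 1 + 1 + 1 by ring, show 2 * (k + 1) = 2 * k + 1 + 1 by ring] at h₂
  simp only [Nat.factorial_succ] at h₂
  rw [← h₁] at h₂
  have hpos : 0 < (k + 1) * ((2 * k).factorial * k.factorial) := by positivity
  refine Nat.eq_of_mul_eq_mul_right hpos ?_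
  rw [show 3 * (k + 1) = 3 * k + 1 + 1 + 1 by ring]
  linear_combination h₂

lemma trinomCoeff_succ (k : ℕ) :
    18 * (2 * k + 1) * (k + 1) * trinomCoeff (k + 1) =
      (9 * (k : ℝ) ^ 2 + 9 * k + 2) * trinomCoeff k := by
  have h : ((2 * k + 1) * (2 * k + 2) * Nat.choose (3 * (k + 1)) (k + 1) : ℝ) =
      3 * (3 * k + 1) * (3 * k + 2) * Nat.choose (3 * k) k := by
    exact_mod_cast choose_three_mul_succ k
  simp only [trinomCoeff, pow_succ]
  field_simp
  linear_combination 9 * h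

lemma harmonicNum_two_mul_succ (k : ℕ) :
    (2 * k + 1) * (2 * k + 2) * harmonicNum (2 * (k + 1)) =
      (2 * k + 1) * (2 * k + 2) * harmonicNum (2 * k) + (4 * k + 3) := by
  rw [show 2 * (k + 1) = 2 * k + 1 + 1 by ring]
  simp only [harmonicNum, Finset.sum_range_succ]
  push_cast
  field_simp
  ring

lemma trinomHarmonicCoeff_succ (k : ℕ) :
    18 * (2 * k + 1) * (k + 1) * trinomHarmonicCoeff (k + 1) =
      (9 * (k : ℝ) ^ 2 + 9 * k + 2) * trinomHarmonicCoeff k +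
        9 * (4 * k + 3) * trinomCoeff (k + 1) := by
  simp only [trinomHarmonicCoeff]
  linear_combination harmonicNum (2 * k) * trinomCoeff_succ k +
    9 * trinomCoeff (k + 1) * harmonicNum_two_mul_succ k

lemma trinomCoeff_nonneg (k : ℕ) : 0 ≤ trinomCoeff k := by
  unfold trinomCoeff
  positivity

lemma trinomCoeff_mul_le_one (k : ℕ) : trinomCoeff k * 4 ^ k ≤ 1 := by
  induction k with
  | zero => simp [trinomCoeff]
  | succ k ih =>
    refine le_trans ?_ ih
    have h := trinomCoeff_succ k
    have h0 := trinomCoeff_nonneg k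
    have hk : (0 : ℝ) ≤ k := k.cast_nonneg
    have h4 : 4 * trinomCoeff (k + 1) ≤ trinomCoeff k := by
      have hpos : (0 : ℝ) < 18 * (2 * k + 1) * (k + 1) := by positivity
      refine le_of_mul_le_mul_left ?_ hpos
      nlinarith [mul_nonneg hk h0]
    rw [pow_succ]
    calc trinomCoeff (k + 1) * (4 ^ k * 4) = 4 * trinomCoeff (k + 1) * 4 ^ k := by ring
      _ ≤ _ := by gcongr

lemma polyGeomBounded_trinomCoeff : PolyGeomBounded trinomCoeff :=
  ⟨1, 0, fun k => by
    simpa [abs_of_nonneg (trinomCoeff_nonneg k)] using trinomCoeff_mul_le_one k⟩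

lemma harmonicNum_nonneg (m : ℕ) : 0 ≤ harmonicNum m :=
  Finset.sum_nonneg fun _ _ => by positivity

lemma harmonicNum_le (m : ℕ) : harmonicNum m ≤ m := by
  have h : ∀ j ∈ Finset.range m, 1 / (j + 1 : ℝ) ≤ 1 := fun j _ => by
    rw [div_le_one (by positivity)]
    linarith [(j.cast_nonneg : (0 : ℝ) ≤ j)]
  simpa [harmonicNum] using Finset.sum_le_sum h

lemma polyGeomBounded_trinomHarmonicCoeff : PolyGeomBounded trinomHarmonicCoeff := by
  refine ⟨2, 1, fun k => ?_⟩
  have hH := harmonicNum_le (2 * k)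
  have hH0 := harmonicNum_nonneg (2 * k)
  have ha := trinomCoeff_nonneg k
  have h1 := trinomCoeff_mul_le_one k
  rw [trinomHarmonicCoeff, abs_of_nonneg (mul_nonneg ha hH0)]
  push_cast at hH
  calc trinomCoeff k * harmonicNum (2 * k) * 4 ^ k
      = (trinomCoeff k * 4 ^ k) * harmonicNum (2 * k) := by ring
    _ ≤ 1 * harmonicNum (2 * k) := by gcongr
    _ ≤ 2 * (k + 1 : ℝ) ^ 1 := by linarith

/-- Coefficientwise form of the differential equation satisfied by `∑ c k * s ^ k`. -/
lemma tsum_ode {c d : ℕ → ℝ} (hc : PolyGeomBounded c) {s e : ℝ} (hs : |s| < 4)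
    (hrec : ∀ k : ℕ, 18 * (2 * k + 1) * (k + 1) * c (k + 1) =
      (9 * (k : ℝ) ^ 2 + 9 * k + 2) * c k + d k) (hd : HasSum (fun k => d k * s ^ k) e) :
    18 * (2 * (s * ∑' k, derivCoeff (derivCoeff c) k * s ^ k) + ∑' k, derivCoeff c k * s ^ k) =
      9 * (s ^ 2 * (∑' k, derivCoeff (derivCoeff c) k * s ^ k) +
        2 * (s * ∑' k, derivCoeff c k * s ^ k)) + 2 * (∑' k, c k * s ^ k) + e := by
  have S₀ := (hc.summable hs).hasSum
  have S₁ := (hc.derivCoeff.summable hs).hasSum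
  have T₁ := hc.hasSum_mul_derivCoeff hs
  have T₂ := hc.derivCoeff.hasSum_mul_derivCoeff hs
  have U₂ : HasSum (fun k : ℕ => (k : ℝ) * (k - 1) * c k * s ^ k)
      (s * (s * ∑' k, derivCoeff (derivCoeff c) k * s ^ k)) := by
    rw [← hasSum_succ_iff_of_zero (by simp)]
    refine (T₂.mul_left s).congr_fun fun k => ?_
    simp only [derivCoeff]
    push_cast
    ring
  have L := ((T₂.mul_left 2).add S₁).mul_left 18
  have R := (((U₂.add (T₁.mul_left 2)).mul_left 9).add (S₀.mul_left 2)).add hd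
  have hLR : _ = _ := L.unique (R.congr_fun fun k => ?_)
  · linear_combination hLR
  · simp only [derivCoeff]
    linear_combination s ^ k * hrec k

/-- The function `v ↦ sin (3 v) * ∑ c k * (4 cos² (3 v)) ^ k`. -/
noncomputable def sinSeries (c : ℕ → ℝ) (v : ℝ) : ℝ :=
  sin (3 * v) * ∑' k, c k * (4 * cos (3 * v) ^ 2) ^ k

/-- The derivative of `sinSeries c`. -/
noncomputable def sinSeriesDeriv (c : ℕ → ℝ) (v : ℝ) : ℝ :=
  3 * cos (3 * v) * ∑' k, c k * (4 * cos (3 * v) ^ 2) ^ k -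
    24 * cos (3 * v) * sin (3 * v) ^ 2 * ∑' k, derivCoeff c k * (4 * cos (3 * v) ^ 2) ^ k

lemma sin_three_mul_pos {v : ℝ} (hv : v ∈ Set.Ioc 0 (π / 6)) : 0 < sin (3 * v) :=
  sin_pos_of_pos_of_lt_pi (by linarith [hv.1]) (by linarith [hv.2, pi_pos])

lemma abs_four_mul_cos_sq_lt {v : ℝ} (hv : v ∈ Set.Ioc 0 (π / 6)) :
    |4 * cos (3 * v) ^ 2| < 4 := by
  have h := sin_three_mul_pos hv
  rw [abs_of_nonneg (by positivity)]
  nlinarith [sin_sq_add_cos_sq (3 * v)]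

lemma hasDerivAt_sin_three_mul (v : ℝ) :
    HasDerivAt (fun x => sin (3 * x)) (3 * cos (3 * v)) v := by
  simpa [mul_comm] using ((hasDerivAt_id v).const_mul 3).sin

lemma hasDerivAt_cos_three_mul (v : ℝ) :
    HasDerivAt (fun x => cos (3 * x)) (-(3 * sin (3 * v))) v := by
  simpa [mul_comm] using ((hasDerivAt_id v).const_mul 3).cos

lemma PolyGeomBounded.hasDerivAt_comp {c : ℕ → ℝ} (hc : PolyGeomBounded c) {v : ℝ}
    (hv : v ∈ Set.Ioc 0 (π / 6)) :
    HasDerivAt (fun x => ∑' k, c k * (4 * cos (3 * x) ^ 2) ^ k)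
      ((∑' k, _root_.derivCoeff c k * (4 * cos (3 * v) ^ 2) ^ k) *
        (-24 * cos (3 * v) * sin (3 * v))) v := by
  have h : HasDerivAt (fun x => 4 * cos (3 * x) ^ 2) _ v :=
    ((hasDerivAt_cos_three_mul v).pow 2).const_mul 4
  refine HasDerivAt.congr_deriv
    (HasDerivAt.comp (h₂ := fun s => ∑' k, c k * s ^ k) v
      (hc.hasDerivAt (abs_four_mul_cos_sq_lt hv)) h) ?_
  push_cast
  ring

lemma hasDerivAt_sinSeries {c : ℕ → ℝ} (hc : PolyGeomBounded c) {v : ℝ}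
    (hv : v ∈ Set.Ioc 0 (π / 6)) : HasDerivAt (sinSeries c) (sinSeriesDeriv c v) v := by
  refine HasDerivAt.congr_deriv ((hasDerivAt_sin_three_mul v).mul (hc.hasDerivAt_comp hv)) ?_
  rw [sinSeriesDeriv]
  ring

lemma hasDerivAt_sinSeriesDeriv {c d : ℕ → ℝ} (hc : PolyGeomBounded c) {v : ℝ} {e : ℝ → ℝ}
    (hrec : ∀ k : ℕ, 18 * (2 * k + 1) * (k + 1) * c (k + 1) =
      (9 * (k : ℝ) ^ 2 + 9 * k + 2) * c k + d k)
    (hd : ∀ s, |s| < 4 → HasSum (fun k => d k * s ^ k) (e s)) (hv : v ∈ Set.Ioc 0 (π / 6)) :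
    HasDerivAt (sinSeriesDeriv c)
      (-sinSeries c v + 4 * sin (3 * v) * e (4 * cos (3 * v) ^ 2)) v := by
  have hs := abs_four_mul_cos_sq_lt hv
  have hC := hasDerivAt_cos_three_mul v
  have hS := hasDerivAt_sin_three_mul v
  have ode := tsum_ode hc hs hrec (hd _ hs)
  have hcs := sin_sq_add_cos_sq (3 * v)
  refine HasDerivAt.congr_deriv (((hC.const_mul 3).mul (hc.hasDerivAt_comp hv)).sub
    (((hC.const_mul 24).mul (hS.pow 2)).mul (hc.derivCoeff.hasDerivAt_comp hv))) ?_
  rw [sinSeries]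
  simp only [Pi.pow_apply, Pi.mul_apply]
  push_cast
  set P := ∑' k, c k * (4 * cos (3 * v) ^ 2) ^ k
  set P₁ := ∑' k, derivCoeff c k * (4 * cos (3 * v) ^ 2) ^ k
  set P₂ := ∑' k, derivCoeff (derivCoeff c) k * (4 * cos (3 * v) ^ 2) ^ k
  set C := cos (3 * v)
  set S := sin (3 * v)
  linear_combination 4 * S * ode + (72 * S * P₁ + 576 * C ^ 2 * S * P₂) * hcs

/-- For `0 < v ≤ π / 6`, with `s = 4 cos² (3 v)`, `∑ C(3k, k) (s / 27) ^ k` has the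
closed form `cos (v - π / 6) / sin (3 v)`; recorded here with its derivative. -/
lemma sinSeries_trinomCoeff {v : ℝ} (hv : v ∈ Set.Ioc 0 (π / 6)) :
    sinSeries trinomCoeff v = cos (v - π / 6) ∧
      sinSeriesDeriv trinomCoeff v = -sin (v - π / 6) := by
  have hb := polyGeomBounded_trinomCoeff
  have hcos : ∀ x, HasDerivAt (fun x => cos (x - π / 6)) (-sin (x - π / 6)) x := fun x => by
    simpa using ((hasDerivAt_id x).sub_const (π / 6)).cos
  have hsin : ∀ x, HasDerivAt (fun x => -sin (x - π / 6)) (-cos (x - π / 6)) x := fun x => by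
    refine HasDerivAt.congr_deriv (((hasDerivAt_id x).sub_const (π / 6)).sin).neg ?_
    simp
  have h0 : 3 * (π / 6) = π / 2 := by ring
  have h := eq_zero_of_harmonic
    (fun x hx => (hasDerivAt_sinSeries hb hx).sub (hcos x))
    (fun x hx => (hasDerivAt_sinSeriesDeriv (d := fun _ => 0) (e := fun _ => 0) hb
      (by simpa using trinomCoeff_succ) (by simp [hasSum_zero]) hx).sub (hsin x))
    (fun x _ => by simp only [Pi.sub_apply]; ring)
    (by
      simp only [Pi.sub_apply, sinSeries, h0, cos_pi_div_two, sin_pi_div_two]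
      rw [tsum_eq_single 0 (fun k hk => by simp [hk])]
      simp [trinomCoeff])
    (by simp [sinSeriesDeriv, h0]) hv
  exact ⟨sub_eq_zero.1 h.1, sub_eq_zero.1 h.2⟩

/-- The inhomogeneous term of the differential equation for the harmonic series. -/
noncomputable def harmonicSource (s : ℝ) : ℝ :=
  9 * (4 * (∑' k, derivCoeff trinomCoeff k * s ^ k) - ∑' k, trinomCoeff (k + 1) * s ^ k)

lemma mul_tsum_succ {s : ℝ} (hs : |s| < 4) :
    s * ∑' k, trinomCoeff (k + 1) * s ^ k = (∑' k, trinomCoeff k * s ^ k) - 1 := by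
  rw [(polyGeomBounded_trinomCoeff.summable hs).tsum_eq_zero_add, ← tsum_mul_left]
  simp only [pow_succ, trinomCoeff]
  simp only [Nat.mul_zero, Nat.choose_self, Nat.cast_one, pow_zero, div_one, mul_one]
  rw [add_sub_cancel_left]
  exact tsum_congr fun k => by ring

lemma summable_trinomCoeff_succ {s : ℝ} (hs : |s| < 4) :
    Summable fun k => trinomCoeff (k + 1) * s ^ k := by
  refine PolyGeomBounded.summable (c := fun k => trinomCoeff (k + 1)) ⟨1, 0, fun k => ?_⟩ hs
  have h := trinomCoeff_mul_le_one (k + 1)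
  have h0 := trinomCoeff_nonneg (k + 1)
  rw [abs_of_nonneg h0]
  have h4 : (0 : ℝ) ≤ trinomCoeff (k + 1) * 4 ^ k := by positivity
  rw [pow_succ] at h
  simp only [pow_zero, mul_one]
  linarith

lemma hasSum_harmonicSource {s : ℝ} (hs : |s| < 4) :
    HasSum (fun k : ℕ => 9 * (4 * k + 3) * trinomCoeff (k + 1) * s ^ k) (harmonicSource s) := by
  have h₁ := (polyGeomBounded_trinomCoeff.derivCoeff.summable hs).hasSum
  have h₂ := (summable_trinomCoeff_succ hs).hasSum
  refine (((h₁.mul_left 4).sub h₂).mul_left 9).congr_fun fun k => ?_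
  simp only [derivCoeff]
  ring

lemma cos_sin_bounds {v : ℝ} (hv : v ∈ Set.Ioc 0 (π / 6)) :
    0 < cos v ∧ 0 < sin v ∧ 0 < √3 * cos v - sin v := by
  refine ⟨cos_pos_of_mem_Ioo ⟨?_, ?_⟩, sin_pos_of_pos_of_lt_pi hv.1 ?_, ?_⟩
  · linarith [hv.1, pi_pos]
  · linarith [hv.2, pi_pos]
  · linarith [hv.2, pi_pos]
  · have h : 0 < sin (π / 3 - v) :=
      sin_pos_of_pos_of_lt_pi (by linarith [hv.2, pi_pos]) (by linarith [hv.1, pi_pos])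
    rw [sin_sub, sin_pi_div_three, cos_pi_div_three] at h
    linarith

lemma harmonicSource_eq {v : ℝ} (hv : v ∈ Set.Ioo 0 (π / 6)) :
    4 * sin (3 * v) * harmonicSource (4 * cos (3 * v) ^ 2) =
      (√3 * cos v + sin v) *
        (3 / (cos v * (cos v + √3 * sin v) * sin v ^ 2 * (√3 * cos v - sin v) ^ 2) -
          9 / (2 * cos v ^ 2 * (cos v + √3 * sin v) ^ 2)) := by
  have hv' : v ∈ Set.Ioc 0 (π / 6) := Set.Ioo_subset_Ioc_self hv
  have hs := abs_four_mul_cos_sq_lt hv'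
  have hS := sin_three_mul_pos hv'
  have hC : 0 < cos (3 * v) :=
    cos_pos_of_mem_Ioo ⟨by linarith [hv.1, pi_pos], by linarith [hv.2]⟩
  obtain ⟨hc, hd, hw⟩ := cos_sin_bounds hv'
  obtain ⟨h₁, h₂⟩ := sinSeries_trinomCoeff hv'
  have h₃ := mul_tsum_succ hs
  rw [sinSeries, cos_sub, cos_pi_div_six, sin_pi_div_six] at h₁
  rw [sinSeriesDeriv, sin_sub, cos_pi_div_six, sin_pi_div_six] at h₂
  rw [harmonicSource]
  have hcs := sin_sq_add_cos_sq v
  have hr : √3 ^ 2 = 3 := by norm_num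
  have e₁ : sin (3 * v) = sin v * (√3 * cos v - sin v) * (√3 * cos v + sin v) := by
    rw [sin_three_mul]
    linear_combination -3 * sin v * hcs - sin v * cos v ^ 2 * hr
  have e₂ : cos (3 * v) = cos v * (cos v - √3 * sin v) * (cos v + √3 * sin v) := by
    rw [cos_three_mul]
    linear_combination 3 * cos v * hcs + cos v * sin v ^ 2 * hr
  set f := ∑' k, trinomCoeff k * (4 * cos (3 * v) ^ 2) ^ k
  set p := ∑' k, derivCoeff trinomCoeff k * (4 * cos (3 * v) ^ 2) ^ k
  set b := ∑' k, trinomCoeff (k + 1) * (4 * cos (3 * v) ^ 2) ^ k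
  clear_value f p b
  have hn : 0 < √3 * cos v + sin v := by positivity
  have hq : 0 < cos v + √3 * sin v := by positivity
  have hm : cos v - √3 * sin v ≠ 0 := fun h => by
    rw [e₂, h] at hC
    simp at hC
  rw [e₁] at h₁
  rw [e₁, e₂] at h₂
  rw [e₂] at h₃
  rw [e₁]
  generalize sin v = d at *
  generalize cos v = c at *
  generalize √3 = r at *
  obtain ⟨w, hw'⟩ : ∃ w, w = r * c - d := ⟨_, rfl⟩
  obtain ⟨q, hq'⟩ : ∃ q, q = c + r * d := ⟨_, rfl⟩
  obtain ⟨m, hm'⟩ : ∃ m, m = c - r * d := ⟨_, rfl⟩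
  obtain ⟨n, hn'⟩ : ∃ n, n = r * c + d := ⟨_, rfl⟩
  rw [← hw'] at hw h₁ h₂ ⊢
  rw [← hq'] at hq h₂ h₃ ⊢
  rw [← hm'] at hm h₂ h₃
  rw [← hn'] at hn h₁ h₂ ⊢
  have hf : 2 * d * w * f = 1 := by
    refine mul_left_cancel₀ hn.ne' ?_
    linear_combination 2 * h₁ - hn'
  have hb : b = 1 / (8 * d * w * c ^ 2 * q ^ 2) := by
    rw [eq_div_iff (by positivity)]
    refine mul_left_cancel₀ (pow_ne_zero 2 hm) ?_
    have hm2 : 1 - 2 * d * w = m ^ 2 := by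
      rw [hw', hm']
      linear_combination -hcs - d ^ 2 * hr
    linear_combination 2 * d * w * h₃ + hf + hm2
  have hp : p = 1 / (48 * c * q * d ^ 3 * w ^ 3) := by
    rw [eq_div_iff (by positivity)]
    refine mul_left_cancel₀ (mul_ne_zero hm (pow_ne_zero 2 hn.ne')) ?_
    have hn2 : n ^ 2 = 3 * c * q - d * w := by
      rw [hn', hq', hw']
      linear_combination c ^ 2 * hr
    linear_combination -2 * d * w * h₂ + 3 * c * m * q * hf - m * hn2 + d * w * hm'
  rw [hb, hp]
  field_simp
  ring

/-- The logarithms in the closed form, as functions of `v = φ / 2`. -/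
noncomputable def logA (v : ℝ) : ℝ := log (cos v + √3 * sin v) - log (sin v) - log (2 * √3)

/-- The second logarithm in the closed form. -/
noncomputable def logB (v : ℝ) : ℝ := log (cos v) - log (√3 * cos v - sin v) + log (2 / √3)

lemma hasDerivAt_logA {v : ℝ} (hv : v ∈ Set.Ioc 0 (π / 6)) :
    HasDerivAt logA (-1 / ((cos v + √3 * sin v) * sin v)) v := by
  obtain ⟨hc, hd, -⟩ := cos_sin_bounds hv
  have hq : 0 < cos v + √3 * sin v := by positivity
  have hcs := sin_sq_add_cos_sq v
  refine HasDerivAt.congr_deriv (((((hasDerivAt_cos v).add ((hasDerivAt_sin v).const_mul √3)).log hq.ne').sub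
    ((hasDerivAt_sin v).log hd.ne')).sub_const (log (2 * √3))) ?_
  simp only [Pi.add_apply]
  field_simp
  linear_combination -hcs

lemma hasDerivAt_logB {v : ℝ} (hv : v ∈ Set.Ioc 0 (π / 6)) :
    HasDerivAt logB (1 / (cos v * (√3 * cos v - sin v))) v := by
  obtain ⟨hc, hd, hw⟩ := cos_sin_bounds hv
  have hcs := sin_sq_add_cos_sq v
  refine HasDerivAt.congr_deriv ((((hasDerivAt_cos v).log hc.ne').sub
    ((((hasDerivAt_cos v).const_mul √3).sub (hasDerivAt_sin v)).log hw.ne')).add_const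
      (log (2 / √3))) ?_
  simp only [Pi.sub_apply]
  obtain ⟨w, hw'⟩ : ∃ w, w = √3 * cos v - sin v := ⟨_, rfl⟩
  rw [← hw'] at hw ⊢
  field_simp
  linear_combination hcs - sin v * hw'

/-- The closed form multiplied by `sin (3 v)`. -/
noncomputable def closedForm (v : ℝ) : ℝ :=
  √3 * cos v * logA v + √3 / 2 * (cos v + √3 * sin v) * logB v

/-- The derivative of `closedForm`. -/
noncomputable def closedFormDeriv (v : ℝ) : ℝ :=
  -(√3 * sin v * logA v) + √3 / 2 * (√3 * cos v - sin v) * logB v -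
    √3 * (cos v / ((cos v + √3 * sin v) * sin v)) +
    √3 / 2 * ((cos v + √3 * sin v) / (cos v * (√3 * cos v - sin v)))

lemma hasDerivAt_closedForm {v : ℝ} (hv : v ∈ Set.Ioc 0 (π / 6)) :
    HasDerivAt closedForm (closedFormDeriv v) v := by
  refine HasDerivAt.congr_deriv ((((hasDerivAt_cos v).const_mul √3).mul (hasDerivAt_logA hv)).add
    ((((hasDerivAt_cos v).add ((hasDerivAt_sin v).const_mul √3)).const_mul (√3 / 2)).mul
      (hasDerivAt_logB hv))) ?_
  simp only [closedFormDeriv, Pi.add_apply]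
  ring

lemma hasDerivAt_closedFormDeriv {v : ℝ} (hv : v ∈ Set.Ioc 0 (π / 6)) :
    HasDerivAt closedFormDeriv (-closedForm v + (√3 * cos v + sin v) *
        (3 / (cos v * (cos v + √3 * sin v) * sin v ^ 2 * (√3 * cos v - sin v) ^ 2) -
          9 / (2 * cos v ^ 2 * (cos v + √3 * sin v) ^ 2))) v := by
  obtain ⟨hc, hd, hw⟩ := cos_sin_bounds hv
  have hq : 0 < cos v + √3 * sin v := by positivity
  have hcs := sin_sq_add_cos_sq v
  have hr : √3 ^ 2 = 3 := by norm_num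
  have dq := (hasDerivAt_cos v).add ((hasDerivAt_sin v).const_mul √3)
  have dw := ((hasDerivAt_cos v).const_mul √3).sub (hasDerivAt_sin v)
  refine HasDerivAt.congr_deriv ((((((hasDerivAt_sin v).const_mul √3).mul (hasDerivAt_logA hv)).neg.add
    ((dw.const_mul (√3 / 2)).mul (hasDerivAt_logB hv))).sub
    (((hasDerivAt_cos v).div (dq.mul (hasDerivAt_sin v)) (by simpa using ⟨hq.ne', hd.ne'⟩)).const_mul
      √3)).add
    ((dq.div ((hasDerivAt_cos v).mul dw) (by simpa using ⟨hc.ne', hw.ne'⟩)).const_mul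
      (√3 / 2))) ?_
  simp only [closedForm, Pi.add_apply, Pi.mul_apply, Pi.sub_apply]
  generalize logA v = A
  generalize logB v = B
  generalize sin v = d at *
  generalize cos v = c at *
  generalize √3 = r at *
  obtain ⟨w, hw'⟩ : ∃ w, w = r * c - d := ⟨_, rfl⟩
  obtain ⟨q, hq'⟩ : ∃ q, q = c + r * d := ⟨_, rfl⟩
  rw [← hw'] at hw ⊢
  rw [← hq'] at hq ⊢
  field_simp
  subst hw' hq'
  linear_combination
    (r * c + d) * (6 * c * (c + r * d) * (d ^ 2 + c ^ 2 + 1) - 9 * d ^ 2 * (r * c - d) ^ 2) * hcs +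
    (2 * r ^ 3 * c ^ 3 * d ^ 4 + 2 * r ^ 3 * c * d ^ 6 + 4 * r ^ 2 * c ^ 6 * d +
      8 * r ^ 2 * c ^ 4 * d ^ 3 + 3 * r ^ 2 * c ^ 2 * d ^ 5 - r ^ 2 * d ^ 7 + 2 * r * c ^ 7 +
      5 * r * c ^ 5 * d ^ 2 + 8 * r * c ^ 3 * d ^ 4 + 5 * r * c * d ^ 6 + 2 * c ^ 6 * d +
      4 * c ^ 4 * d ^ 3 - c ^ 2 * d ^ 5 - 3 * d ^ 7) * hr

lemma sinSeries_trinomHarmonicCoeff {v : ℝ} (hv : v ∈ Set.Ioc 0 (π / 6)) :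
    sinSeries trinomHarmonicCoeff v = closedForm v := by
  have hb := polyGeomBounded_trinomHarmonicCoeff
  have h0 : 3 * (π / 6) = π / 2 := by ring
  have hr : √3 * √3 = 3 := by norm_num
  have hA : logA (π / 6) = 0 := by
    rw [logA, cos_pi_div_six, sin_pi_div_six, ← log_div (by positivity) (by positivity),
      ← log_div (by positivity) (by positivity)]
    convert log_one using 2
    field_simp
    ring
  have hB : logB (π / 6) = 0 := by
    have h1 : √3 * (√3 / 2) - 1 / 2 = 1 := by linarith
    rw [logB, cos_pi_div_six, sin_pi_div_six, h1, log_one, sub_zero,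
      ← log_mul (by positivity) (by positivity)]
    convert log_one using 2
    field_simp
  have h := eq_zero_of_harmonic
    (fun x hx => (hasDerivAt_sinSeries hb hx).sub (hasDerivAt_closedForm hx))
    (fun x hx => (hasDerivAt_sinSeriesDeriv hb trinomHarmonicCoeff_succ
      (fun s hs => hasSum_harmonicSource hs) hx).sub (hasDerivAt_closedFormDeriv hx))
    (fun x hx => by
      rw [harmonicSource_eq hx]
      simp only [Pi.sub_apply]
      ring)
    (by
      simp only [Pi.sub_apply, sinSeries, closedForm, hA, hB, h0, cos_pi_div_two, sin_pi_div_two]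
      rw [tsum_eq_single 0 (fun k hk => by simp [hk])]
      simp [trinomHarmonicCoeff, harmonicNum])
    (by
      simp only [sinSeriesDeriv, closedFormDeriv, hA, hB, h0, cos_pi_div_two,
        cos_pi_div_six, sin_pi_div_six]
      have h1 : √3 * (√3 / 2) - 1 / 2 = 1 := by linarith
      rw [h1]
      ring) hv
  exact sub_eq_zero.1 h.1

theorem sun_3k_H2k_log (φ : ℝ) (h0 : 0 < φ) (h1 : φ < π / 3) :
    ∑' k : ℕ, ((Nat.choose (3 * k) k : ℝ) / 27 ^ k) * (2 * cos (3 * φ / 2)) ^ (2 * k) *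
        harmonicNum (2 * k) =
      (Real.sqrt 3 / sin (3 * φ / 2)) *
        (cos (φ / 2) *
            Real.log (2 * cos (φ / 2) * cos (φ / 2 - π / 3) / (Real.sqrt 3 * sin φ)) +
          cos (φ / 2 - π / 3) *
            Real.log (2 * cos (φ / 2) * cos (φ / 2 - π / 3) /
              (Real.sqrt 3 * sin (2 * π / 3 - φ)))) := by
  have hv : φ / 2 ∈ Set.Ioc 0 (π / 6) := ⟨by linarith, by linarith⟩
  have h := sinSeries_trinomHarmonicCoeff hv
  have hS := sin_three_mul_pos hv
  obtain ⟨hc, hd, hw⟩ := cos_sin_bounds hv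
  have hr : √3 * √3 = 3 := by norm_num
  have hq : 0 < cos (φ / 2) + √3 * sin (φ / 2) := by positivity
  have e1 : cos (φ / 2 - π / 3) = (cos (φ / 2) + √3 * sin (φ / 2)) / 2 := by
    rw [cos_sub, cos_pi_div_three, sin_pi_div_three]
    ring
  have e2 : sin φ = 2 * sin (φ / 2) * cos (φ / 2) := by
    rw [← sin_two_mul]
    ring_nf
  have e3 : sin (2 * π / 3 - φ) =
      (√3 * cos (φ / 2) - sin (φ / 2)) * (cos (φ / 2) + √3 * sin (φ / 2)) / 2 := by
    rw [show 2 * π / 3 - φ = 2 * (π / 3 - φ / 2) by ring, sin_two_mul, sin_sub, cos_sub,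
      cos_pi_div_three, sin_pi_div_three]
    ring
  have hA : log (2 * cos (φ / 2) * cos (φ / 2 - π / 3) / (√3 * sin φ)) = logA (φ / 2) := by
    rw [logA, ← log_div hq.ne' hd.ne', ← log_div (by positivity) (by positivity), e1, e2]
    congr 1
    field_simp
  have hB : log (2 * cos (φ / 2) * cos (φ / 2 - π / 3) / (√3 * sin (2 * π / 3 - φ))) =
      logB (φ / 2) := by
    rw [logB, ← log_div hc.ne' hw.ne', ← log_mul (by positivity) (by positivity), e1, e3]
    congr 1
    field_simp
  rw [hA, hB, e1, show 3 * φ / 2 = 3 * (φ / 2) by ring, div_mul_eq_mul_div, eq_div_iff hS.ne',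
    mul_comm]
  have hsum : (∑' k : ℕ, ((Nat.choose (3 * k) k : ℝ) / 27 ^ k) *
      (2 * cos (3 * (φ / 2))) ^ (2 * k) * harmonicNum (2 * k)) =
      ∑' k, trinomHarmonicCoeff k * (4 * cos (3 * (φ / 2)) ^ 2) ^ k :=
    tsum_congr fun k => by
      rw [trinomHarmonicCoeff, trinomCoeff, pow_mul, mul_pow]
      ring
  rw [hsum]
  rw [sinSeries, closedForm] at h
  rw [h]
  ring
end
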